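/- Let d ≥ 1, let μ₁, μ₂ ∈ ℝ^d and let σ₁, σ₂ ∈ ℝ^d have nonnegative entries, and let p = ⊗_{i=1}^d N(μ₁ᵢ, σ₁ᵢ²) and q = ⊗_{i=1}^d N(μ₂ᵢ, σ₂ᵢ²) be the corresponding Gaussian product measures on ℝ^d. Then the squared 2-Wasserstein distance between p and q, i.e., the infimum over all couplings π of p and q of ∫ ‖x−y‖₂² dπ, equals ‖μ₁ − μ₂‖₂² + Σ_{i=1}^d (σ₁ᵢ − σ₂ᵢ)², and the infimum is attained by the pushforward of the standard Gaussian on ℝ^d under the map z ↦ (μ₁ + σ₁ ⊙ z, μ₂ + σ₂ ⊙ z), where ⊙ denotes coordinatewise multiplication. -/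

import Mathlib

open MeasureTheory ProbabilityTheory

theorem covariance_sq_le_variance_mul_variance {Ω : Type*} [MeasurableSpace Ω] {P : Measure Ω}
    [IsFiniteMeasure P] {X Y : Ω → ℝ} (hX : MemLp X 2 P) (hY : MemLp Y 2 P) :
    cov[X, Y; P] ^ 2 ≤ Var[X; P] * Var[Y; P] := by
  have h : ∀ t : ℝ, 0 ≤ Var[X; P] * (t * t) + (-2 * cov[X, Y; P]) * t + Var[Y; P] := fun t => by
    have hv := variance_nonneg (fun ω => t * X ω - Y ω) P
    rw [variance_fun_sub (hX.const_mul t) hY, variance_const_mul, covariance_const_mul_left] at hv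
    linarith
  have := discrim_le_zero h
  rw [discrim] at this
  linarith

/-- Gelbrich's lower bound on the real line. -/
theorem sq_sub_add_sq_sub_le_integral_sq_sub {Ω : Type*} [MeasurableSpace Ω] {P : Measure Ω}
    [IsProbabilityMeasure P] {X Y : Ω → ℝ} (hX : MemLp X 2 P) (hY : MemLp Y 2 P) {s t : ℝ}
    (hs : 0 ≤ s) (ht : 0 ≤ t) (hXs : Var[X; P] = s ^ 2) (hYt : Var[Y; P] = t ^ 2) :
    (P[X] - P[Y]) ^ 2 + (s - t) ^ 2 ≤ ∫ ω, (X ω - Y ω) ^ 2 ∂P := by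
  have hcov : cov[X, Y; P] ≤ s * t := by
    have h := covariance_sq_le_variance_mul_variance hX hY
    rw [hXs, hYt, ← mul_pow] at h
    exact le_of_abs_le (abs_le_of_sq_le_sq h (by positivity))
  have hvar := variance_eq_sub (hX.sub hY)
  rw [variance_sub hX hY, hXs, hYt] at hvar
  have hmean : P[X - Y] = P[X] - P[Y] :=
    integral_sub (hX.integrable one_le_two) (hY.integrable one_le_two)
  rw [hmean] at hvar
  have hsq : P[(X - Y) ^ 2] = ∫ ω, (X ω - Y ω) ^ 2 ∂P := rfl
  rw [hsq] at hvar
  linarith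

theorem map_affine_gaussianReal (m s : ℝ) :
    (gaussianReal 0 1).map (fun z => m + s * z) = gaussianReal m (s ^ 2).toNNReal := by
  have h : (fun z : ℝ => m + s * z) = (fun z => m + z) ∘ (fun z => s * z) := rfl
  rw [h, ← Measure.map_map (by fun_prop) (by fun_prop), gaussianReal_map_const_mul,
    gaussianReal_map_const_add]
  congr 1
  · simp
  · rw [mul_one]
    exact (Real.toNNReal_of_nonneg (sq_nonneg s)).symm

theorem map_affine_pi_gaussianReal {ι : Type*} [Fintype ι] (m s : ι → ℝ) :
    (Measure.pi fun _ : ι => gaussianReal 0 1).map (fun z i => m i + s i * z i) =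
      Measure.pi fun i => gaussianReal (m i) ((s i) ^ 2).toNNReal := by
  have (i : ι) : SigmaFinite ((gaussianReal 0 1).map fun z => m i + s i * z) := by
    rw [map_affine_gaussianReal]; infer_instance
  rw [Measure.pi_map_pi (f := fun i z => m i + s i * z) fun i => by fun_prop]
  simp_rw [map_affine_gaussianReal]

theorem hasLaw_eval_of_map_eq_pi {Ω ι : Type*} [MeasurableSpace Ω] {P : Measure Ω} [Fintype ι]
    {f : Ω → ι → ℝ} (hf : Measurable f) {ν : ι → Measure ℝ} [∀ i, IsProbabilityMeasure (ν i)]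
    (h : P.map f = Measure.pi ν) (i : ι) : HasLaw (fun ω => f ω i) (ν i) P :=
  (measurePreserving_eval ν i).hasLaw.comp ⟨hf.aemeasurable, h⟩

theorem ProbabilityTheory.HasLaw.memLp_two_of_gaussianReal {Ω : Type*} [MeasurableSpace Ω] {P : Measure Ω}
    {X : Ω → ℝ} {m : ℝ} {v : NNReal} (hX : HasLaw X (gaussianReal m v) P) : MemLp X 2 P := by
  have h : MemLp id 2 (P.map X) := hX.map_eq ▸ memLp_id_gaussianReal 2
  exact (memLp_map_measure_iff h.aestronglyMeasurable hX.aemeasurable).1 h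

theorem le_integral_sum_sq_sub {Ω ι : Type*} [MeasurableSpace Ω] {P : Measure Ω}
    [IsProbabilityMeasure P] [Fintype ι] {X Y : Ω → ι → ℝ} {m₁ m₂ s₁ s₂ : ι → ℝ}
    (hs₁ : ∀ i, 0 ≤ s₁ i) (hs₂ : ∀ i, 0 ≤ s₂ i)
    (hX : ∀ i, HasLaw (fun ω => X ω i) (gaussianReal (m₁ i) ((s₁ i) ^ 2).toNNReal) P)
    (hY : ∀ i, HasLaw (fun ω => Y ω i) (gaussianReal (m₂ i) ((s₂ i) ^ 2).toNNReal) P) :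
    (∑ i, (m₁ i - m₂ i) ^ 2) + ∑ i, (s₁ i - s₂ i) ^ 2 ≤ ∫ ω, ∑ i, (X ω i - Y ω i) ^ 2 ∂P := by
  have hX2 i := (hX i).memLp_two_of_gaussianReal
  have hY2 i := (hY i).memLp_two_of_gaussianReal
  have hint i : Integrable (fun ω => (X ω i - Y ω i) ^ 2) P := ((hX2 i).sub (hY2 i)).integrable_sq
  rw [integral_finsetSum _ fun i _ => hint i, ← Finset.sum_add_distrib]
  refine Finset.sum_le_sum fun i _ => ?_
  have h := sq_sub_add_sq_sub_le_integral_sq_sub (hX2 i) (hY2 i) (hs₁ i) (hs₂ i)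
    (by simp [(hX i).variance_eq, sq_nonneg]) (by simp [(hY i).variance_eq, sq_nonneg])
  simpa [(hX i).integral_eq, (hY i).integral_eq] using h

theorem integral_sq_affine_gaussianReal (a b : ℝ) :
    ∫ z, (a + b * z) ^ 2 ∂gaussianReal 0 1 = a ^ 2 + b ^ 2 := by
  have hlaw : HasLaw (fun z => a + b * z) (gaussianReal a (b ^ 2).toNNReal) (gaussianReal 0 1) :=
    ⟨by fun_prop, map_affine_gaussianReal a b⟩
  have h := variance_eq_sub hlaw.memLp_two_of_gaussianReal
  rw [hlaw.variance_eq, hlaw.integral_eq] at h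
  simp [sq_nonneg] at h
  linarith

theorem integral_sum_sq_affine_pi_gaussianReal {ι : Type*} [Fintype ι] (a b : ι → ℝ) :
    ∫ z, ∑ i, (a i + b i * z i) ^ 2 ∂(Measure.pi fun _ : ι => gaussianReal 0 1) =
      (∑ i, a i ^ 2) + ∑ i, b i ^ 2 := by
  have hmeas : Measurable fun (z : ι → ℝ) i => a i + b i * z i := by fun_prop
  have hlaw i := hasLaw_eval_of_map_eq_pi hmeas (map_affine_pi_gaussianReal a b) i
  rw [integral_finsetSum _ fun i _ => (hlaw i).memLp_two_of_gaussianReal.integrable_sq,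
    ← Finset.sum_add_distrib]
  refine Finset.sum_congr rfl fun i _ => ?_
  rw [← integral_sq_affine_gaussianReal]
  exact integral_comp_eval (μ := fun _ : ι => gaussianReal 0 1)
    (f := fun x => (a i + b i * x) ^ 2) (by fun_prop)

/-- For Gaussian product measures `p = ⊗ᵢ N(μ₁ᵢ, σ₁ᵢ²)` and `q = ⊗ᵢ N(μ₂ᵢ, σ₂ᵢ²)` on
`ℝ^d` (diagonal covariance), the squared 2-Wasserstein distance — the infimum of the
quadratic cost over all couplings — equals `‖μ₁ − μ₂‖₂² + Σᵢ (σ₁ᵢ − σ₂ᵢ)²`, and the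
infimum is attained by the pushforward of the standard Gaussian on `ℝ^d` under
`z ↦ (μ₁ + σ₁ ⊙ z, μ₂ + σ₂ ⊙ z)`. -/
theorem diag_gaussian_W2sq_eq
    (d : ℕ) (hd : 1 ≤ d) (μ₁ μ₂ σ₁ σ₂ : Fin d → ℝ)
    (hσ₁ : ∀ i, 0 ≤ σ₁ i) (hσ₂ : ∀ i, 0 ≤ σ₂ i) :
    IsLeast {c : ℝ | ∃ π : Measure ((Fin d → ℝ) × (Fin d → ℝ)), IsProbabilityMeasure π ∧
          π.fst = (Measure.pi fun i => gaussianReal (μ₁ i) ((σ₁ i) ^ 2).toNNReal) ∧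
          π.snd = (Measure.pi fun i => gaussianReal (μ₂ i) ((σ₂ i) ^ 2).toNNReal) ∧
          c = ∫ z, ∑ i, (z.1 i - z.2 i) ^ 2 ∂π}
        ((∑ i, (μ₁ i - μ₂ i) ^ 2) + ∑ i, (σ₁ i - σ₂ i) ^ 2) ∧
    (Measure.map (fun z : Fin d → ℝ =>
          ((fun i => μ₁ i + σ₁ i * z i), (fun i => μ₂ i + σ₂ i * z i)))
        (Measure.pi fun _ : Fin d => gaussianReal 0 1)).fst =
      (Measure.pi fun i => gaussianReal (μ₁ i) ((σ₁ i) ^ 2).toNNReal) ∧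
    (Measure.map (fun z : Fin d → ℝ =>
          ((fun i => μ₁ i + σ₁ i * z i), (fun i => μ₂ i + σ₂ i * z i)))
        (Measure.pi fun _ : Fin d => gaussianReal 0 1)).snd =
      (Measure.pi fun i => gaussianReal (μ₂ i) ((σ₂ i) ^ 2).toNNReal) ∧
    (∫ z, ∑ i, (z.1 i - z.2 i) ^ 2 ∂(Measure.map (fun z : Fin d → ℝ =>
          ((fun i => μ₁ i + σ₁ i * z i), (fun i => μ₂ i + σ₂ i * z i)))
        (Measure.pi fun _ : Fin d => gaussianReal 0 1))) =
      (∑ i, (μ₁ i - μ₂ i) ^ 2) + ∑ i, (σ₁ i - σ₂ i) ^ 2 := by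
  set γ : Measure (Fin d → ℝ) := Measure.pi fun _ : Fin d => gaussianReal 0 1
  set T : (Fin d → ℝ) → (Fin d → ℝ) × (Fin d → ℝ) := fun z =>
    ((fun i => μ₁ i + σ₁ i * z i), (fun i => μ₂ i + σ₂ i * z i))
  have hT : Measurable T := by fun_prop
  have hfst : (γ.map T).fst = Measure.pi fun i => gaussianReal (μ₁ i) ((σ₁ i) ^ 2).toNNReal := by
    rw [Measure.fst, Measure.map_map measurable_fst hT]
    exact map_affine_pi_gaussianReal μ₁ σ₁
  have hsnd : (γ.map T).snd = Measure.pi fun i => gaussianReal (μ₂ i) ((σ₂ i) ^ 2).toNNReal := by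
    rw [Measure.snd, Measure.map_map measurable_snd hT]
    exact map_affine_pi_gaussianReal μ₂ σ₂
  have hcost : ∫ z, ∑ i, (z.1 i - z.2 i) ^ 2 ∂(γ.map T) =
      (∑ i, (μ₁ i - μ₂ i) ^ 2) + ∑ i, (σ₁ i - σ₂ i) ^ 2 := by
    rw [integral_map hT.aemeasurable (by fun_prop), ← integral_sum_sq_affine_pi_gaussianReal]
    refine integral_congr_ae (.of_forall fun z => Finset.sum_congr rfl fun i _ => ?_)
    simp only [T]
    ring
  refine ⟨⟨⟨γ.map T, Measure.isProbabilityMeasure_map hT.aemeasurable, hfst, hsnd, hcost.symm⟩,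
    ?_⟩, hfst, hsnd, hcost⟩
  rintro _ ⟨π, _, h₁, h₂, rfl⟩
  exact le_integral_sum_sq_sub hσ₁ hσ₂
    (hasLaw_eval_of_map_eq_pi measurable_fst h₁)
    (hasLaw_eval_of_map_eq_pi measurable_snd h₂)
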